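/- arXiv:1607.03046 — 2 statements merged into one kernel-verified Lean document; each statement's English description precedes it below -/
import Mathlib

section
/- For all 1 ≤ k ≤ n, the number of rooted labeled forests on [n] avoiding both 312 and 213 (unimodal forests) that have exactly k top-down maxima equals k!·c(n,k), where c(n,k) is the unsigned Stirling number of the first kind. -/
/-- A rooted labeled forest on `[n]`, encoded as a parent function
`p : Fin n → Option (Fin n)` (`p v = none` means `v` is a root).
Acyclicity is expressed by the existence of a depth function strictly
decreasing from each vertex to its parent. -/
def IsForest {n : ℕ} (p : Fin n → Option (Fin n)) : Prop :=
  ∃ d : Fin n → ℕ, ∀ v w : Fin n, p v = some w → d w < d v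

/-- `StrictAnc p a b` means `a` is a strict ancestor of `b` in the forest `p`. -/
def StrictAnc {n : ℕ} (p : Fin n → Option (Fin n)) (a b : Fin n) : Prop :=
  Relation.TransGen (fun x y : Fin n => p y = some x) a b

/-- The forest `p` contains the pattern `σ` (given in one-line notation):
there is a chain of vertices along some root-to-vertex path whose labels
are order-isomorphic to `σ`. -/
def ForestContains {n : ℕ} (p : Fin n → Option (Fin n)) (σ : List ℕ) : Prop :=
  ∃ u : Fin σ.length → Fin n,
    (∀ i j : Fin σ.length, i < j → StrictAnc p (u i) (u j)) ∧
    (∀ i j : Fin σ.length, σ.get i < σ.get j ↔ u i < u j)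

/-- The forest `p` avoids the pattern `σ`. -/
def ForestAvoids {n : ℕ} (p : Fin n → Option (Fin n)) (σ : List ℕ) : Prop :=
  ¬ ForestContains p σ

/-- Number of cycles (including fixed points) in the cycle decomposition of a
permutation. -/
def permNumCycles {n : ℕ} (π : Equiv.Perm (Fin n)) : ℕ :=
  π.cycleType.card + (Finset.univ.filter fun x => π x = x).card

/-- Unsigned Stirling number of the first kind: the number of permutations of
`[n]` with exactly `k` cycles. -/
noncomputable def stirlingFirst (n k : ℕ) : ℕ :=
  Nat.card {π : Equiv.Perm (Fin n) // permNumCycles π = k}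

/-- Stirling number of the second kind: the number of partitions of `[n]`
into `k` nonempty subsets. -/
noncomputable def stirlingSecond (n k : ℕ) : ℕ :=
  Nat.card {P : Finpartition (Finset.univ : Finset (Fin n)) // P.parts.card = k}

/-- The Bell number: the number of set partitions of `[n]`. -/
noncomputable def bellNumber (n : ℕ) : ℕ :=
  Nat.card (Finpartition (Finset.univ : Finset (Fin n)))

/-- A vertex is a top-down maximum if it is larger than all of its ancestors. -/
def IsTopDownMax {n : ℕ} (p : Fin n → Option (Fin n)) (v : Fin n) : Prop :=
  ∀ u : Fin n, StrictAnc p u v → u < v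

theorem cycle_count_swap_mul_of_isCycle {α : Type*} [Fintype α] [DecidableEq α]
    {c : Equiv.Perm α} (hc : c.IsCycle) {x : α} (hx : c x ≠ x) :
    (Equiv.swap x (c x) * c).cycleType.card + c.support.card =
      (Equiv.swap x (c x) * c).support.card + 2 := by
  by_cases h : c (c x) = x
  · have h1 := hc.eq_swap_of_apply_apply_eq_self hx h
    have h2 : c.support.card = 2 := by
      rw [h1]; exact Equiv.Perm.card_support_swap (Ne.symm hx)
    have h3 : Equiv.swap x (c x) * c = 1 := by
      nth_rewrite 2 [h1]; exact Equiv.swap_mul_self _ _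
    rw [h3, h2]; simp
  · have h1 := hc.swap_mul hx h
    rw [h1.cycleType, Equiv.Perm.support_swap_mul_eq _ _ h,
      Finset.card_sdiff_of_subset (by simpa using hx)]
    have := Finset.card_pos.2 ⟨x, Equiv.Perm.mem_support.2 hx⟩
    simp; omega

theorem cycle_count_swap_mul {α : Type*} [Fintype α] [DecidableEq α]
    (g : Equiv.Perm α) {x : α} (hx : g x ≠ x) :
    (Equiv.swap x (g x) * g).cycleType.card + g.support.card =
      g.cycleType.card + (Equiv.swap x (g x) * g).support.card + 1 := by
  set c := g.cycleOf x with hcdef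
  have hc : c.IsCycle := g.isCycle_cycleOf hx
  have hcx : c x = g x := g.cycleOf_apply_self x
  obtain ⟨r, hr⟩ : ∃ r, r = g * c⁻¹ := ⟨_, rfl⟩
  have hd : r.Disjoint c := hr ▸ Equiv.Perm.disjoint_mul_inv_of_mem_cycleFactorsFinset
    (Equiv.Perm.cycleOf_mem_cycleFactorsFinset_iff.2 (Equiv.Perm.mem_support.2 hx))
  have hg : g = c * r := by rw [← hd.commute.eq, hr]; group
  have hd' : (Equiv.swap x (c x) * c).Disjoint r := by
    rw [Equiv.Perm.disjoint_iff_disjoint_support] at hd ⊢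
    refine hd.symm.mono_left fun y hy => ?_
    exact (Equiv.Perm.mem_support_swap_mul_imp_mem_support_ne hy).1
  have key := cycle_count_swap_mul_of_isCycle hc (hcx ▸ hx)
  rw [← hcx]
  have e : Equiv.swap x (c x) * g = (Equiv.swap x (c x) * c) * r := by rw [mul_assoc, ← hg]
  rw [e, hd'.cycleType_mul, hd'.card_support_mul, hg, hd.symm.cycleType_mul,
    hd.symm.card_support_mul, hc.cycleType]
  simp only [Multiset.card_add, Multiset.card_singleton]
  omega

theorem permNumCycles_add_card_support {n : ℕ} (g : Equiv.Perm (Fin n)) :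
    permNumCycles g + g.support.card = g.cycleType.card + n := by
  have h := Finset.card_filter_add_card_filter_not
    (s := (Finset.univ : Finset (Fin n))) (fun x => g x = x)
  rw [Finset.card_univ, Fintype.card_fin] at h
  unfold permNumCycles Equiv.Perm.support
  simp only [ne_eq]
  omega

theorem permNumCycles_swap_mul {n : ℕ} (g : Equiv.Perm (Fin n)) {x : Fin n} (hx : g x ≠ x) :
    permNumCycles (Equiv.swap x (g x) * g) = permNumCycles g + 1 := by
  have h1 := permNumCycles_add_card_support g
  have h2 := permNumCycles_add_card_support (Equiv.swap x (g x) * g)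
  have h3 := cycle_count_swap_mul g hx
  omega

theorem permNumCycles_decomposeFin_symm_zero {n : ℕ} (e : Equiv.Perm (Fin n)) :
    permNumCycles (Equiv.Perm.decomposeFin.symm (0, e)) = permNumCycles e + 1 := by
  have h : Equiv.Perm.decomposeFin.symm (0, e) = e.extendDomain (finSuccAboveEquiv 0) := by
    ext x
    refine Fin.cases ?_ (fun i => ?_) x
    · rw [Equiv.Perm.extendDomain_apply_not_subtype _ _ (by simp)]
      simp
    · have := e.extendDomain_apply_image (finSuccAboveEquiv 0) i
      simp only [finSuccAboveEquiv_apply, Fin.zero_succAbove] at this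
      simp [this]
  have hc : (Equiv.Perm.decomposeFin.symm (0, e)).cycleType = e.cycleType := by
    rw [h, Equiv.Perm.cycleType_extendDomain]
  unfold permNumCycles
  rw [hc, Fin.card_filter_univ_succ]
  simp
  omega

theorem permNumCycles_decomposeFin_symm_succ {n : ℕ} (i : Fin n) (e : Equiv.Perm (Fin n)) :
    permNumCycles (Equiv.Perm.decomposeFin.symm (i.succ, e)) = permNumCycles e := by
  set g := Equiv.Perm.decomposeFin.symm (i.succ, e) with hg
  have h0 : g 0 = i.succ := by simp [hg]
  have h1 := permNumCycles_swap_mul g (x := 0) (by rw [h0]; exact Fin.succ_ne_zero i)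
  have h2 : Equiv.swap 0 (g 0) * g = Equiv.Perm.decomposeFin.symm (0, e) := by
    rw [h0]
    ext x
    refine Fin.cases ?_ (fun j => ?_) x <;> simp [hg]
  rw [h2, permNumCycles_decomposeFin_symm_zero] at h1
  omega

theorem sum_permNumCycles_succ (n : ℕ) (f : ℕ → ℕ) :
    ∑ π : Equiv.Perm (Fin (n + 1)), f (permNumCycles π) =
      n * ∑ π : Equiv.Perm (Fin n), f (permNumCycles π) +
        ∑ π : Equiv.Perm (Fin n), f (permNumCycles π + 1) := by
  rw [← Equiv.Perm.decomposeFin.symm.sum_comp, Fintype.sum_prod_type, Fin.sum_univ_succ]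
  simp [permNumCycles_decomposeFin_symm_zero, permNumCycles_decomposeFin_symm_succ, add_comm]

/-- The strict ancestor relation of a forest whose roots are coloured by `C`: each vertex is sent
either to its parent or, if it is a root, to its colour. -/
def ColoredAnc {n : ℕ} {C : Type} (p : Fin n → C ⊕ Fin n) (a b : Fin n) : Prop :=
  Relation.TransGen (fun x y : Fin n => p y = Sum.inr x) a b

/-- Acyclicity together with the absence of a vertex having both a larger ancestor and a larger
descendant. -/
structure IsUnimodalForest {n : ℕ} {C : Type} (p : Fin n → C ⊕ Fin n) : Prop where
  acyclic : ∃ d : Fin n → ℕ, ∀ v w : Fin n, p v = Sum.inr w → d w < d v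
  no_valley : ∀ a b c : Fin n, ColoredAnc p a b → ColoredAnc p b c → b < a → ¬ b < c

open Classical in
/-- The number of top-down maxima of a root-coloured forest. -/
noncomputable def maxCount {n : ℕ} {C : Type} (p : Fin n → C ⊕ Fin n) : ℕ :=
  (Finset.univ.filter fun v => ∀ u, ColoredAnc p u v → u < v).card

/-- Unimodal forests on `Fin n` with roots coloured by `C`. -/
def UnimodalForest (n : ℕ) (C : Type) : Type :=
  {p : Fin n → C ⊕ Fin n // IsUnimodalForest p}

noncomputable instance (n : ℕ) (C : Type) [Finite C] : Fintype (UnimodalForest n C) :=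
  @Fintype.ofFinite _ (inferInstanceAs (Finite {p : Fin n → C ⊕ Fin n // IsUnimodalForest p}))

theorem not_coloredAnc_of_root {n : ℕ} {C : Type} {p : Fin n → C ⊕ Fin n} {a b : Fin n} {c : C}
    (hb : p b = Sum.inl c) : ¬ ColoredAnc p a b := by
  intro h
  obtain ⟨x, -, hx⟩ := Relation.TransGen.tail'_iff.1 h
  simp [hb] at hx

theorem not_coloredAnc_of_leaf {n : ℕ} {C : Type} {p : Fin n → C ⊕ Fin n} {a b : Fin n}
    (ha : ∀ v, p v ≠ Sum.inr a) : ¬ ColoredAnc p a b := by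
  intro h
  obtain ⟨x, hx, -⟩ := Relation.TransGen.head'_iff.1 h
  exact ha x hx

theorem coloredAnc_succ_iff {n : ℕ} {C D : Type} {p : Fin (n + 1) → C ⊕ Fin (n + 1)}
    {q : Fin n → D ⊕ Fin n} (h : ∀ a b : Fin n, p b.succ = Sum.inr a.succ ↔ q b = Sum.inr a)
    (h0 : (∃ c, p 0 = Sum.inl c) ∨ ∀ b, p b ≠ Sum.inr 0) (a b : Fin n) :
    ColoredAnc p a.succ b.succ ↔ ColoredAnc q a b := by
  constructor
  · intro hab
    suffices H : ∀ x, ColoredAnc p a.succ x → ∀ b : Fin n, x = b.succ → ColoredAnc q a b from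
      H _ hab b rfl
    intro x hx
    induction hx with
    | single hx =>
      rintro b rfl
      exact .single ((h _ _).1 hx)
    | @tail y z hy hyz ih =>
      rintro b rfl
      obtain rfl | ⟨y, rfl⟩ := Fin.eq_zero_or_eq_succ y
      · obtain ⟨c, hc⟩ | h0 := h0
        · exact (not_coloredAnc_of_root hc hy).elim
        · exact (h0 _ hyz).elim
      · exact (ih y rfl).tail ((h _ _).1 hyz)
  · intro hab
    induction hab with
    | single hb => exact .single ((h _ _).2 hb)
    | tail _ hb ih => exact ih.tail ((h _ _).2 hb)

/-- Add a new smallest vertex as a leaf below `w`. -/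
def addLeaf {n : ℕ} {C : Type} (w : Fin n) (q : Fin n → C ⊕ Fin n) :
    Fin (n + 1) → C ⊕ Fin (n + 1) :=
  Fin.cons (Sum.inr w.succ) fun v => (q v).map id Fin.succ

/-- Turn the extra root colour `none` into an edge to the new smallest vertex. -/
def shiftParent {n : ℕ} {C : Type} : Option C ⊕ Fin n → C ⊕ Fin (n + 1)
  | Sum.inl none => Sum.inr 0
  | Sum.inl (some c) => Sum.inl c
  | Sum.inr v => Sum.inr v.succ

/-- Add a new smallest vertex as a root coloured `c`, whose children are the roots coloured
`none`. -/
def addRoot {n : ℕ} {C : Type} (c : C) (q : Fin n → Option C ⊕ Fin n) :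
    Fin (n + 1) → C ⊕ Fin (n + 1) :=
  Fin.cons (Sum.inl c) fun v => shiftParent (q v)

theorem shiftParent_injective {n : ℕ} {C : Type} :
    Function.Injective (shiftParent : Option C ⊕ Fin n → C ⊕ Fin (n + 1)) := by
  rintro ((_ | x) | x) ((_ | y) | y) h <;>
    simp_all [shiftParent, Fin.succ_ne_zero, (Fin.succ_ne_zero _).symm]

theorem shiftParent_surjective {n : ℕ} {C : Type} :
    Function.Surjective (shiftParent : Option C ⊕ Fin n → C ⊕ Fin (n + 1)) := by
  rintro (c | v)
  · exact ⟨Sum.inl (some c), rfl⟩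
  · obtain rfl | ⟨v, rfl⟩ := Fin.eq_zero_or_eq_succ v
    · exact ⟨Sum.inl none, rfl⟩
    · exact ⟨Sum.inr v, rfl⟩

section AddLeaf

variable {n : ℕ} {C : Type} (w : Fin n) (q : Fin n → C ⊕ Fin n)

theorem addLeaf_succ_eq_inr_iff (a b : Fin n) :
    addLeaf w q b.succ = Sum.inr a.succ ↔ q b = Sum.inr a := by
  simp only [addLeaf, Fin.cons_succ]
  rcases q b with c | v <;> simp

theorem addLeaf_ne_inr_zero (b : Fin (n + 1)) : addLeaf w q b ≠ Sum.inr 0 := by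
  obtain rfl | ⟨b, rfl⟩ := Fin.eq_zero_or_eq_succ b
  · simp [addLeaf, Fin.succ_ne_zero]
  · simp only [addLeaf, Fin.cons_succ]
    rcases q b with c | v <;> simp [Fin.succ_ne_zero]

theorem coloredAnc_addLeaf (a b : Fin n) :
    ColoredAnc (addLeaf w q) a.succ b.succ ↔ ColoredAnc q a b :=
  coloredAnc_succ_iff (addLeaf_succ_eq_inr_iff w q) (.inr (addLeaf_ne_inr_zero w q)) a b

theorem isUnimodalForest_addLeaf : IsUnimodalForest (addLeaf w q) ↔ IsUnimodalForest q := by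
  constructor
  · rintro ⟨⟨d, hd⟩, hv⟩
    refine ⟨⟨fun v => d v.succ, fun v u h => hd _ _ ((addLeaf_succ_eq_inr_iff w q u v).2 h)⟩, ?_⟩
    intro a b c hab hbc h1 h2
    exact hv _ _ _ ((coloredAnc_addLeaf w q a b).2 hab) ((coloredAnc_addLeaf w q b c).2 hbc)
      (Fin.succ_lt_succ_iff.2 h1) (Fin.succ_lt_succ_iff.2 h2)
  · rintro ⟨⟨d, hd⟩, hv⟩
    refine ⟨⟨Fin.cons (d w + 1) d, fun v u h => ?_⟩, ?_⟩
    · obtain rfl | ⟨u, rfl⟩ := Fin.eq_zero_or_eq_succ u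
      · exact (addLeaf_ne_inr_zero w q v h).elim
      obtain rfl | ⟨v, rfl⟩ := Fin.eq_zero_or_eq_succ v
      · simp only [addLeaf, Fin.cons_zero, Sum.inr.injEq, Fin.succ_inj] at h
        simp [h]
      · simpa using hd _ _ ((addLeaf_succ_eq_inr_iff w q u v).1 h)
    · intro a b c hab hbc h1 h2
      obtain ⟨a, rfl⟩ := Fin.exists_succ_eq.2 (Fin.ne_zero_of_lt h1)
      obtain ⟨c, rfl⟩ := Fin.exists_succ_eq.2 (Fin.ne_zero_of_lt h2)
      obtain rfl | ⟨b, rfl⟩ := Fin.eq_zero_or_eq_succ b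
      · exact not_coloredAnc_of_leaf (addLeaf_ne_inr_zero w q) hbc
      · exact hv _ _ _ ((coloredAnc_addLeaf w q a b).1 hab) ((coloredAnc_addLeaf w q b c).1 hbc)
          (Fin.succ_lt_succ_iff.1 h1) (Fin.succ_lt_succ_iff.1 h2)

theorem maxCount_addLeaf : maxCount (addLeaf w q) = maxCount q := by
  classical
  unfold maxCount
  rw [Fin.card_filter_univ_succ, if_neg]
  · congr 1
    ext v
    simp only [Finset.mem_filter, Finset.mem_univ, true_and, Fin.forall_fin_succ,
      coloredAnc_addLeaf, Fin.succ_lt_succ_iff]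
    exact and_iff_right fun h => (not_coloredAnc_of_leaf (addLeaf_ne_inr_zero w q) h).elim
  · intro h
    exact absurd (h w.succ (.single (by simp [addLeaf]))) (Fin.not_lt_zero _)

end AddLeaf

section AddRoot

variable {n : ℕ} {C : Type} (c : C) (q : Fin n → Option C ⊕ Fin n)

theorem addRoot_succ_eq_inr_iff (a b : Fin n) :
    addRoot c q b.succ = Sum.inr a.succ ↔ q b = Sum.inr a := by
  simp only [addRoot, Fin.cons_succ]
  exact shiftParent_injective.eq_iff' rfl

theorem addRoot_zero : addRoot c q 0 = Sum.inl c := rfl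

theorem coloredAnc_addRoot (a b : Fin n) :
    ColoredAnc (addRoot c q) a.succ b.succ ↔ ColoredAnc q a b :=
  coloredAnc_succ_iff (addRoot_succ_eq_inr_iff c q) (.inl ⟨c, rfl⟩) a b

theorem isUnimodalForest_addRoot : IsUnimodalForest (addRoot c q) ↔ IsUnimodalForest q := by
  constructor
  · rintro ⟨⟨d, hd⟩, hv⟩
    refine ⟨⟨fun v => d v.succ, fun v u h => hd _ _ ((addRoot_succ_eq_inr_iff c q u v).2 h)⟩, ?_⟩
    intro x y z hxy hyz h1 h2
    exact hv _ _ _ ((coloredAnc_addRoot c q x y).2 hxy) ((coloredAnc_addRoot c q y z).2 hyz)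
      (Fin.succ_lt_succ_iff.2 h1) (Fin.succ_lt_succ_iff.2 h2)
  · rintro ⟨⟨d, hd⟩, hv⟩
    refine ⟨⟨Fin.cons 0 fun v => d v + 1, fun v u h => ?_⟩, ?_⟩
    · obtain rfl | ⟨v, rfl⟩ := Fin.eq_zero_or_eq_succ v
      · simp [addRoot_zero] at h
      obtain rfl | ⟨u, rfl⟩ := Fin.eq_zero_or_eq_succ u
      · simp
      · simpa using hd _ _ ((addRoot_succ_eq_inr_iff c q u v).1 h)
    · intro x y z hxy hyz h1 h2
      obtain ⟨x, rfl⟩ := Fin.exists_succ_eq.2 (Fin.ne_zero_of_lt h1)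
      obtain ⟨z, rfl⟩ := Fin.exists_succ_eq.2 (Fin.ne_zero_of_lt h2)
      obtain rfl | ⟨y, rfl⟩ := Fin.eq_zero_or_eq_succ y
      · exact not_coloredAnc_of_root (addRoot_zero c q) hxy
      · exact hv _ _ _ ((coloredAnc_addRoot c q x y).1 hxy) ((coloredAnc_addRoot c q y z).1 hyz)
          (Fin.succ_lt_succ_iff.1 h1) (Fin.succ_lt_succ_iff.1 h2)

theorem maxCount_addRoot : maxCount (addRoot c q) = maxCount q + 1 := by
  classical
  unfold maxCount
  rw [Fin.card_filter_univ_succ,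
    if_pos fun u h => (not_coloredAnc_of_root (addRoot_zero c q) h).elim]
  congr 2
  ext v
  simp [Fin.forall_fin_succ, coloredAnc_addRoot]

end AddRoot

/-- A nonempty unimodal forest arises uniquely by adding a smallest vertex as a leaf or a root. -/
def addSmallest {n : ℕ} {C : Type} :
    (Fin n × UnimodalForest n C) ⊕ (C × UnimodalForest n (Option C)) → UnimodalForest (n + 1) C
  | Sum.inl (w, q) => ⟨addLeaf w q.1, (isUnimodalForest_addLeaf w q.1).2 q.2⟩
  | Sum.inr (c, q) => ⟨addRoot c q.1, (isUnimodalForest_addRoot c q.1).2 q.2⟩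

theorem addSmallest_injective {n : ℕ} {C : Type} :
    Function.Injective (addSmallest (n := n) (C := C)) := by
  rintro (⟨w, q⟩ | ⟨c, q⟩) (⟨w', q'⟩ | ⟨c', q'⟩) h <;>
    have h := congrArg Subtype.val h <;>
    simp only [addSmallest, addLeaf, addRoot] at h <;>
    obtain ⟨h0, h1⟩ := Fin.cons_inj.1 h
  · obtain rfl := Fin.succ_injective _ (Sum.inr_injective h0)
    have : q = q' := Subtype.ext <| funext fun v =>
      (Function.injective_id.sumMap (Fin.succ_injective n)) (congrFun h1 v)
    rw [this]
  · cases h0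
  · cases h0
  · obtain rfl := Sum.inl_injective h0
    have : q = q' := Subtype.ext <| funext fun v => shiftParent_injective (congrFun h1 v)
    rw [this]

theorem addSmallest_surjective {n : ℕ} {C : Type} :
    Function.Surjective (addSmallest (n := n) (C := C)) := by
  rintro ⟨p, hp⟩
  rcases h0 : p 0 with c | x
  · choose q hq using fun v : Fin n => shiftParent_surjective (p v.succ)
    have e : addRoot c q = p := by
      funext v
      refine Fin.cases ?_ (fun v => ?_) v
      · exact h0.symm
      · exact hq v
    exact ⟨Sum.inr (c, ⟨q, (isUnimodalForest_addRoot c q).1 (e ▸ hp)⟩), Subtype.ext e⟩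
  · obtain ⟨d, hd⟩ := hp.acyclic
    obtain rfl | ⟨w, rfl⟩ := Fin.eq_zero_or_eq_succ x
    · exact absurd (hd _ _ h0) (lt_irrefl _)
    have hs : ∀ v : Fin n, ∃ y : C ⊕ Fin n, y.map id Fin.succ = p v.succ := by
      intro v
      rcases hv : p v.succ with c | y
      · exact ⟨Sum.inl c, rfl⟩
      · obtain rfl | ⟨y, rfl⟩ := Fin.eq_zero_or_eq_succ y
        · exact (hp.no_valley _ _ _ (.single h0) (.single hv) (Fin.succ_pos _)
            (Fin.succ_pos _)).elim
        · exact ⟨Sum.inr y, rfl⟩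
    choose q hq using hs
    have e : addLeaf w q = p := by
      funext v
      refine Fin.cases ?_ (fun v => ?_) v
      · exact h0.symm
      · exact hq v
    exact ⟨Sum.inl (w, ⟨q, (isUnimodalForest_addLeaf w q).1 (e ▸ hp)⟩), Subtype.ext e⟩

theorem sum_maxCount_succ (n : ℕ) (C : Type) [Fintype C] (f : ℕ → ℕ) :
    ∑ p : UnimodalForest (n + 1) C, f (maxCount p.1) =
      n * ∑ p : UnimodalForest n C, f (maxCount p.1) +
        Fintype.card C * ∑ p : UnimodalForest n (Option C), f (maxCount p.1 + 1) := by
  rw [← Function.Bijective.sum_comp ⟨addSmallest_injective, addSmallest_surjective⟩,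
    Fintype.sum_sum_type, Fintype.sum_prod_type, Fintype.sum_prod_type]
  simp [addSmallest, maxCount_addLeaf, maxCount_addRoot]

theorem sum_maxCount_eq (n : ℕ) (C : Type) [Fintype C] (f : ℕ → ℕ) :
    ∑ p : UnimodalForest n C, f (maxCount p.1) =
      ∑ π : Equiv.Perm (Fin n),
        f (permNumCycles π) * (Fintype.card C).ascFactorial (permNumCycles π) := by
  induction n generalizing C f with
  | zero =>
    have h : ∀ p : UnimodalForest 0 C, maxCount p.1 = 0 := fun p => by simp [maxCount]
    have hc : Fintype.card (UnimodalForest 0 C) = 1 :=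
      Fintype.card_eq_one_iff.2 ⟨⟨Fin.elim0, ⟨⟨Fin.elim0, fun v => v.elim0⟩, fun a => a.elim0⟩⟩,
        fun p => Subtype.ext (funext fun v => v.elim0)⟩
    simp [h, hc, permNumCycles]
  | succ n ih =>
    rw [sum_maxCount_succ, ih, ih (Option C) fun j => f (j + 1),
      sum_permNumCycles_succ n fun j => f j * (Fintype.card C).ascFactorial j,
      Finset.mul_sum (a := Fintype.card C)]
    congr 1
    refine Finset.sum_congr rfl fun π _ => ?_
    rw [Fintype.card_option, mul_left_comm, Nat.succ_ascFactorial, Nat.ascFactorial_succ]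

theorem forestContains_iff {n : ℕ} (p : Fin n → Option (Fin n)) (x y z : ℕ) :
    ForestContains p [x, y, z] ↔ ∃ a b c, StrictAnc p a b ∧ StrictAnc p b c ∧
      (x < y ↔ a < b) ∧ (y < x ↔ b < a) ∧ (x < z ↔ a < c) ∧ (z < x ↔ c < a) ∧
      (y < z ↔ b < c) ∧ (z < y ↔ c < b) := by
  constructor
  · rintro ⟨u, h1, h2⟩
    exact ⟨u 0, u 1, u 2, h1 0 1 (by simp), h1 1 2 (show (1 : Fin 3) < 2 by decide), h2 0 1, h2 1 0, h2 0 2, h2 2 0,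
      h2 1 2, h2 2 1⟩
  · rintro ⟨a, b, c, hab, hbc, h⟩
    refine ⟨![a, b, c], ?_, ?_⟩
    · have hac : StrictAnc p a c := Relation.TransGen.trans hab hbc
      intro i j hij
      change Fin 3 at i j
      fin_cases i <;> fin_cases j <;> simp_all
    · intro i j
      change Fin 3 at i j
      fin_cases i <;> fin_cases j <;> simp_all

theorem StrictAnc.irrefl {n : ℕ} {p : Fin n → Option (Fin n)} (hp : IsForest p) (a : Fin n) :
    ¬ StrictAnc p a a := by
  obtain ⟨d, hd⟩ := hp
  have H : ∀ b, StrictAnc p a b → d a < d b := by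
    intro b h
    induction h with
    | single h => exact hd _ _ h
    | tail _ h ih => exact ih.trans (hd _ _ h)
  exact fun h => lt_irrefl _ (H a h)

theorem forestAvoids_and_iff {n : ℕ} {p : Fin n → Option (Fin n)} (hp : IsForest p) :
    (ForestAvoids p [3, 1, 2] ∧ ForestAvoids p [2, 1, 3]) ↔
      ∀ a b c : Fin n, StrictAnc p a b → StrictAnc p b c → b < a → ¬ b < c := by
  unfold ForestAvoids
  rw [forestContains_iff, forestContains_iff]
  constructor
  · rintro ⟨h1, h2⟩ a b c hab hbc h3 h4
    rcases lt_trichotomy a c with h | rfl | h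
    · exact h2 ⟨a, b, c, hab, hbc, by simp; omega⟩
    · exact StrictAnc.irrefl hp a (Relation.TransGen.trans hab hbc)
    · exact h1 ⟨a, b, c, hab, hbc, by simp; omega⟩
  · intro h
    constructor <;> rintro ⟨a, b, c, hab, hbc, h1⟩ <;> exact h a b c hab hbc (by omega) (by omega)

/-- A parent function, seen as a root-coloured forest with a single colour. -/
def unitColoring (n : ℕ) : (Fin n → Option (Fin n)) ≃ (Fin n → Unit ⊕ Fin n) :=
  (Equiv.refl _).arrowCongr ((Equiv.optionEquivSumPUnit _).trans (Equiv.sumComm _ _))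

theorem unitColoring_eq_inr_iff {n : ℕ} (p : Fin n → Option (Fin n)) (v w : Fin n) :
    unitColoring n p v = Sum.inr w ↔ p v = some w := by
  rcases h : p v with _ | x <;> simp [unitColoring, h]

theorem coloredAnc_unitColoring {n : ℕ} (p : Fin n → Option (Fin n)) (a b : Fin n) :
    ColoredAnc (unitColoring n p) a b ↔ StrictAnc p a b := by
  simp only [ColoredAnc, StrictAnc, unitColoring_eq_inr_iff]

theorem isUnimodalForest_unitColoring {n : ℕ} (p : Fin n → Option (Fin n)) :
    IsUnimodalForest (unitColoring n p) ↔
      IsForest p ∧ ForestAvoids p [3, 1, 2] ∧ ForestAvoids p [2, 1, 3] := by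
  have h : IsUnimodalForest (unitColoring n p) ↔ IsForest p ∧
      ∀ a b c : Fin n, StrictAnc p a b → StrictAnc p b c → b < a → ¬ b < c := by
    have h1 : IsUnimodalForest (unitColoring n p) ↔ _ ∧ _ :=
      ⟨fun h => ⟨h.1, h.2⟩, fun h => ⟨h.1, h.2⟩⟩
    simpa only [coloredAnc_unitColoring, unitColoring_eq_inr_iff, IsForest] using h1
  rw [h]
  exact and_congr_right fun hp => (forestAvoids_and_iff hp).symm

theorem maxCount_unitColoring {n : ℕ} (p : Fin n → Option (Fin n)) :
    maxCount (unitColoring n p) = Nat.card {v : Fin n // IsTopDownMax p v} := by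
  classical
  rw [Nat.card_eq_fintype_card, Fintype.card_subtype, maxCount]
  congr 1
  ext v
  simp only [Finset.mem_filter, Finset.mem_univ, true_and, coloredAnc_unitColoring]
  rfl

theorem count_unimodal_forests_by_topdown_maxima (n k : ℕ) (hk : 1 ≤ k) (hkn : k ≤ n) :
    Nat.card {p : Fin n → Option (Fin n) //
        IsForest p ∧ ForestAvoids p [3, 1, 2] ∧ ForestAvoids p [2, 1, 3] ∧
        Nat.card {v : Fin n // IsTopDownMax p v} = k} =
    k.factorial * stirlingFirst n k := by
  classical
  have e : {p : Fin n → Option (Fin n) //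
        IsForest p ∧ ForestAvoids p [3, 1, 2] ∧ ForestAvoids p [2, 1, 3] ∧
        Nat.card {v : Fin n // IsTopDownMax p v} = k} ≃
      {p : UnimodalForest n Unit // maxCount p.1 = k} :=
    ((unitColoring n).subtypeEquiv fun p => by
      rw [isUnimodalForest_unitColoring, maxCount_unitColoring, and_assoc, and_assoc]).trans
      (Equiv.subtypeSubtypeEquivSubtypeInter IsUnimodalForest fun p => maxCount p = k).symm
  have h := sum_maxCount_eq n Unit fun j => if j = k then 1 else 0
  rw [Nat.card_congr e, Nat.card_eq_fintype_card, Fintype.card_subtype, Finset.card_filter, h,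
    stirlingFirst, Nat.card_eq_fintype_card, Fintype.card_subtype, Finset.card_filter,
    Finset.mul_sum]
  refine Finset.sum_congr rfl fun π _ => ?_
  split_ifs with hπ
  · simp [hπ, Nat.one_ascFactorial]
  · simp
end

section
/- For all n ≥ 1, the number of rooted labeled forests on [n] avoiding all three patterns 312, 213, and 321 equals ∑_{k=1}^{n} k!·S(n,k), where S(n,k) is the Stirling number of the second kind. -/
open Finset

/-- Every non-leaf vertex that is not a root is larger than its parent. -/
def InternalIncreasing {n : ℕ} (p : Fin n → Option (Fin n)) : Prop :=
  ∀ u v w : Fin n, p u = some v → p v = some w → w < v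

/-- A closure operator on `Fin n`, without the monotonicity requirement. -/
def IdempotentInflationary {n : ℕ} (g : Fin n → Fin n) : Prop :=
  (∀ v, v ≤ g v) ∧ ∀ v, g (g v) = g v

lemma StrictAnc.depth_lt {n : ℕ} {p : Fin n → Option (Fin n)} {d : Fin n → ℕ}
    (hd : ∀ v w : Fin n, p v = some w → d w < d v) {a b : Fin n} (h : StrictAnc p a b) :
    d a < d b := by
  unfold StrictAnc at h
  induction h with
  | single h => exact hd _ _ h
  | tail _ h ih => exact ih.trans (hd _ _ h)

lemma InternalIncreasing.isForest {n : ℕ} {p : Fin n → Option (Fin n)}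
    (h : InternalIncreasing p) : IsForest p := by
  classical
  refine ⟨fun v => if ∃ u, p u = some v then v.val else n, fun v w hvw => ?_⟩
  have hw : ∃ u, p u = some w := ⟨v, hvw⟩
  simp only [hw, if_true]
  split_ifs with hv
  · obtain ⟨u, hu⟩ := hv
    exact h u v w hu hvw
  · exact w.isLt

lemma InternalIncreasing.lt_of_strictAnc {n : ℕ} {p : Fin n → Option (Fin n)}
    (h : InternalIncreasing p) {a b : Fin n} (hab : StrictAnc p a b) :
    ∀ c, p c = some b → a < b := by
  unfold StrictAnc at hab
  induction hab with
  | single hb => exact fun c hc => h _ _ _ hc hb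
  | tail _ hb ih => exact fun c hc => (ih _ hb).trans (h _ _ _ hc hb)

lemma StrictAnc.exists_child {n : ℕ} {p : Fin n → Option (Fin n)} {a b : Fin n}
    (hab : StrictAnc p a b) : ∃ c, p c = some a := by
  obtain ⟨c, hc, _⟩ := Relation.TransGen.head'_iff.mp hab
  exact ⟨c, hc⟩

lemma InternalIncreasing.avoids {n : ℕ} {p : Fin n → Option (Fin n)}
    (h : InternalIncreasing p) {a b c : ℕ} (hab : b < a) : ForestAvoids p [a, b, c] := by
  rintro ⟨u, hu, hlt⟩
  obtain ⟨c, hc⟩ := (hu 1 2 (by simp [Fin.lt_def])).exists_child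
  have h01 := h.lt_of_strictAnc (hu 0 1 (by simp)) c hc
  exact absurd ((hlt 1 0).mp hab) h01.asymm

lemma forestContains_of_chain {n : ℕ} {p : Fin n → Option (Fin n)} {a b c : ℕ} {x y z : Fin n}
    (hxy : p y = some x) (hyz : p z = some y)
    (h : ∀ i j : Fin 3, ![a, b, c] i < ![a, b, c] j ↔ ![x, y, z] i < ![x, y, z] j) :
    ForestContains p [a, b, c] := by
  have h1 : StrictAnc p x y := Relation.TransGen.single hxy
  have h2 : StrictAnc p y z := Relation.TransGen.single hyz
  have h3 : StrictAnc p x z := Relation.TransGen.trans h1 h2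
  have hchain : ∀ i j : Fin 3, i < j → StrictAnc p (![x, y, z] i) (![x, y, z] j) := by
    intro i j hij
    fin_cases i <;> fin_cases j <;> first | exact absurd hij (by decide) | assumption
  refine ⟨![x, y, z], hchain, fun i j => ?_⟩
  · change Fin 3 at i j
    refine Iff.trans ?_ (h i j)
    fin_cases i <;> fin_cases j <;> rfl

lemma isForest_and_avoids_iff {n : ℕ} (p : Fin n → Option (Fin n)) :
    (IsForest p ∧ ForestAvoids p [3, 1, 2] ∧ ForestAvoids p [2, 1, 3] ∧
      ForestAvoids p [3, 2, 1]) ↔ InternalIncreasing p := by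
  refine ⟨?_, fun h => ⟨h.isForest, h.avoids (by norm_num), h.avoids (by norm_num),
    h.avoids (by norm_num)⟩⟩
  rintro ⟨⟨d, hd⟩, h312, h213, h321⟩ u v w huv hvw
  have h1 := hd _ _ huv
  have h2 := hd _ _ hvw
  have hvw' : v ≠ w := by rintro rfl; omega
  have huv' : u ≠ v := by rintro rfl; omega
  have huw' : u ≠ w := by rintro rfl; omega
  by_contra hlt
  have hvltw : v < w := by omega
  rcases lt_or_gt_of_ne huv' with h | h
  · refine h321 (forestContains_of_chain hvw huv fun i j => ?_)
    fin_cases i <;> fin_cases j <;> simp <;> omega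
  · rcases lt_or_gt_of_ne huw' with h' | h'
    · refine h312 (forestContains_of_chain hvw huv fun i j => ?_)
      fin_cases i <;> fin_cases j <;> simp <;> omega
    · refine h213 (forestContains_of_chain hvw huv fun i j => ?_)
      fin_cases i <;> fin_cases j <;> simp <;> omega

lemma prod_one_add_card_filter_lt {α : Type*} [LinearOrder α] (M : Finset α) :
    ∏ v ∈ M, (1 + #{m ∈ M | m < v}) = (#M).factorial := by
  induction M using Finset.induction_on_max with
  | empty => simp
  | insert a s ha ih =>
    have has : a ∉ s := fun h => lt_irrefl _ (ha a h)
    have h1 : ({m ∈ insert a s | m < a} : Finset α) = s := by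
      ext m
      simp only [mem_filter, mem_insert]
      exact ⟨fun ⟨h, hm⟩ => h.resolve_left hm.ne, fun h => ⟨Or.inr h, ha m h⟩⟩
    have h2 : ∀ v ∈ s, ({m ∈ insert a s | m < v} : Finset α) = {m ∈ s | m < v} := fun v hv => by
      rw [filter_insert, if_neg (ha v hv).asymm]
    rw [prod_insert has, h1, card_insert_of_notMem has, Nat.factorial_succ, ← ih,
      prod_congr rfl fun v hv => by rw [h2 v hv], ih, add_comm]

/-- The map that fixes the vertices larger than their parent and sends every other vertex to its
parent. -/
def toParentOrSelf {n : ℕ} (p : Fin n → Option (Fin n)) (v : Fin n) : Fin n :=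
  max v ((p v).getD v)

lemma toParentOrSelf_none {n : ℕ} {p : Fin n → Option (Fin n)} {v : Fin n} (h : p v = none) :
    toParentOrSelf p v = v := by
  simp [toParentOrSelf, h]

lemma toParentOrSelf_some {n : ℕ} {p : Fin n → Option (Fin n)} {v w : Fin n} (h : p v = some w) :
    toParentOrSelf p v = max v w := by
  simp [toParentOrSelf, h]

lemma InternalIncreasing.toParentOrSelf_parent {n : ℕ} {p : Fin n → Option (Fin n)}
    (h : InternalIncreasing p) {v w : Fin n} (hvw : p v = some w) :
    toParentOrSelf p w = w := by
  rcases hw : p w with _ | x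
  · exact toParentOrSelf_none hw
  · rw [toParentOrSelf_some hw, max_eq_left (h _ _ _ hvw hw).le]

lemma InternalIncreasing.idempotentInflationary {n : ℕ} {p : Fin n → Option (Fin n)}
    (h : InternalIncreasing p) : IdempotentInflationary (toParentOrSelf p) := by
  refine ⟨fun v => le_max_left _ _, fun v => ?_⟩
  rcases hv : p v with _ | w
  · simp only [toParentOrSelf_none hv]
  · rcases le_total w v with hwv | hwv
    · have : toParentOrSelf p v = v := by rw [toParentOrSelf_some hv, max_eq_left hwv]
      simp only [this]
    · rw [toParentOrSelf_some hv, max_eq_right hwv, h.toParentOrSelf_parent hv]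

/-- The parents that `v` may have in a forest whose associated map is `g`. -/
def allowedParents {n : ℕ} (g : Fin n → Fin n) (v : Fin n) : Finset (Option (Fin n)) :=
  if g v = v then insertNone {m ∈ ({m | g m = m} : Finset (Fin n)) | m < v} else {some (g v)}

lemma internalIncreasing_and_toParentOrSelf_eq_iff {n : ℕ} {g : Fin n → Fin n}
    (hg : IdempotentInflationary g) (p : Fin n → Option (Fin n)) :
    InternalIncreasing p ∧ toParentOrSelf p = g ↔ ∀ v, p v ∈ allowedParents g v := by
  constructor
  · rintro ⟨h, rfl⟩ v
    unfold allowedParents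
    rcases hv : p v with _ | w
    · simp [toParentOrSelf_none hv]
    · have hw := h.toParentOrSelf_parent hv
      have hne : w ≠ v := by
        rintro rfl
        exact lt_irrefl _ (h _ _ _ hv hv)
      split_ifs with hfix
      · rw [toParentOrSelf_some hv, max_eq_left_iff] at hfix
        simpa [hw] using lt_of_le_of_ne hfix hne
      · rw [toParentOrSelf_some hv] at hfix ⊢
        rw [max_eq_left_iff, not_le] at hfix
        rw [max_eq_right hfix.le, mem_singleton]
  · intro h
    have key : ∀ v w, p v = some w → g w = w ∧ (g v = v ∧ w < v ∨ g v ≠ v ∧ w = g v) := by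
      intro v w hv
      have hm := h v
      rw [hv, allowedParents] at hm
      split_ifs at hm with hfix
      · simp only [some_mem_insertNone, mem_filter, mem_univ, true_and] at hm
        exact ⟨hm.1, Or.inl ⟨hfix, hm.2⟩⟩
      · have hw : w = g v := by simpa using hm
        exact ⟨hw ▸ hg.2 v, Or.inr ⟨hfix, hw⟩⟩
    refine ⟨fun u v w huv hvw => ?_, funext fun v => ?_⟩
    · have h1 := (key u v huv).1
      rcases (key v w hvw).2 with h2 | h2
      · exact h2.2
      · exact absurd h1 h2.1
    · rcases hv : p v with _ | w
      · have hm := h v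
        rw [hv, allowedParents] at hm
        rw [toParentOrSelf_none hv]
        split_ifs at hm with hfix
        · exact hfix.symm
        · simp at hm
      · rw [toParentOrSelf_some hv]
        rcases (key v w hv).2 with h2 | h2
        · rw [max_eq_left h2.2.le, h2.1]
        · rw [h2.2, max_eq_right (hg.1 v)]

lemma prod_card_allowedParents {n : ℕ} (g : Fin n → Fin n) :
    ∏ v, #(allowedParents g v) = (#{v | g v = v}).factorial := by
  rw [← prod_one_add_card_filter_lt, prod_filter]
  refine prod_congr rfl fun v _ => ?_
  unfold allowedParents
  split_ifs
  · rw [card_insertNone, add_comm]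
  · simp

open scoped Classical in
lemma card_internalIncreasing (n : ℕ) :
    #{p : Fin n → Option (Fin n) | InternalIncreasing p} =
      ∑ g : Fin n → Fin n with IdempotentInflationary g, (#{v | g v = v}).factorial := by
  rw [card_eq_sum_card_fiberwise (f := toParentOrSelf) (t := {g | IdempotentInflationary g})]
  · refine sum_congr rfl fun g hg => ?_
    rw [← prod_card_allowedParents, ← Fintype.card_piFinset]
    congr 1
    ext p
    rw [Fintype.mem_piFinset, ← internalIncreasing_and_toParentOrSelf_eq_iff (mem_filter.mp hg).2]
    simp
  · intro p hp
    simpa using (mem_filter.mp (mem_coe.mp hp)).2.idempotentInflationary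

/-- The map sending every element to the maximum of its block. -/
def blockMax {n : ℕ} (P : Finpartition (univ : Finset (Fin n))) (v : Fin n) : Fin n :=
  (P.part v).max' ⟨v, P.mem_part (mem_univ v)⟩

lemma blockMax_mem {n : ℕ} (P : Finpartition (univ : Finset (Fin n))) (v : Fin n) :
    blockMax P v ∈ P.part v :=
  max'_mem _ _

lemma part_blockMax {n : ℕ} (P : Finpartition (univ : Finset (Fin n))) (v : Fin n) :
    P.part (blockMax P v) = P.part v :=
  P.part_eq_of_mem (P.part_mem.mpr (mem_univ v)) (blockMax_mem P v)

lemma blockMax_congr {n : ℕ} (P : Finpartition (univ : Finset (Fin n))) {v w : Fin n}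
    (h : P.part v = P.part w) : blockMax P v = blockMax P w := by
  simp only [blockMax, h]

lemma blockMax_eq_iff {n : ℕ} (P : Finpartition (univ : Finset (Fin n))) {v w : Fin n} :
    blockMax P v = blockMax P w ↔ P.part v = P.part w :=
  ⟨fun h => by rw [← part_blockMax P v, h, part_blockMax], blockMax_congr P⟩

lemma idempotentInflationary_blockMax {n : ℕ} (P : Finpartition (univ : Finset (Fin n))) :
    IdempotentInflationary (blockMax P) :=
  ⟨fun v => le_max' _ _ (P.mem_part (mem_univ v)), fun v => blockMax_congr P (part_blockMax P v)⟩

lemma card_fixed_blockMax {n : ℕ} (P : Finpartition (univ : Finset (Fin n))) :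
    #{v | blockMax P v = v} = #P.parts := by
  refine card_bij (fun v _ => P.part v) (fun v _ => P.part_mem.mpr (mem_univ v))
    (fun v hv w hw h => ?_) fun s hs => ?_
  · rw [mem_filter] at hv hw
    rw [← hv.2, ← hw.2, blockMax_congr P h]
  · obtain ⟨v, hv⟩ := P.nonempty_of_mem_parts hs
    refine ⟨blockMax P v, ?_, ?_⟩
    · simpa using (idempotentInflationary_blockMax P).2 v
    · rw [part_blockMax, P.part_eq_of_mem hs hv]

lemma blockMax_injective {n : ℕ} : Function.Injective (blockMax (n := n)) := by
  intro P Q h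
  have hpart : ∀ v, P.part v = Q.part v := fun v => by
    ext w
    rw [P.mem_part_iff_part_eq_part (mem_univ _) (mem_univ _),
      Q.mem_part_iff_part_eq_part (mem_univ _) (mem_univ _), ← blockMax_eq_iff, ← blockMax_eq_iff, h]
  have hsub : ∀ P Q : Finpartition (univ : Finset (Fin n)), (∀ v, P.part v = Q.part v) →
      P.parts ⊆ Q.parts := fun P Q hPQ s hs => by
    obtain ⟨v, hv⟩ := P.nonempty_of_mem_parts hs
    rw [← P.part_eq_of_mem hs hv, hPQ]
    exact Q.part_mem.mpr (mem_univ v)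
  exact Finpartition.ext ((hsub P Q hpart).antisymm (hsub Q P fun v => (hpart v).symm))

lemma exists_blockMax_eq {n : ℕ} {g : Fin n → Fin n} (hg : IdempotentInflationary g) :
    ∃ P, blockMax P = g := by
  classical
  let P := Finpartition.ofSetoid (Setoid.ker g)
  have hmem : ∀ v w, w ∈ P.part v ↔ g v = g w := fun v w =>
    Finpartition.mem_part_ofSetoid_iff_rel
  refine ⟨P, funext fun v => le_antisymm ?_ ?_⟩
  · rw [(hmem v _).mp (blockMax_mem P v)]
    exact hg.1 _
  · exact le_max' _ _ ((hmem v _).mpr (hg.2 v).symm)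

open scoped Classical in
lemma sum_idempotentInflationary (n : ℕ) (f : ℕ → ℕ) :
    ∑ g : Fin n → Fin n with IdempotentInflationary g, f (#{v | g v = v}) =
      ∑ P : Finpartition (univ : Finset (Fin n)), f (#P.parts) := by
  symm
  refine sum_bij (fun P _ => blockMax P) (fun P _ => ?_) (fun P _ Q _ h => blockMax_injective h)
    (fun g hg => ?_) fun P _ => by rw [card_fixed_blockMax]
  · simpa using idempotentInflationary_blockMax P
  · obtain ⟨P, hP⟩ := exists_blockMax_eq (mem_filter.mp hg).2
    exact ⟨P, mem_univ _, hP⟩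

lemma sum_card_parts_eq_sum_stirlingSecond {n : ℕ} (hn : 1 ≤ n) (f : ℕ → ℕ) :
    ∑ P : Finpartition (univ : Finset (Fin n)), f (#P.parts) =
      ∑ k ∈ Icc 1 n, f k * stirlingSecond n k := by
  classical
  have hmaps : ∀ P ∈ (univ : Finset (Finpartition (univ : Finset (Fin n)))),
      #P.parts ∈ Icc 1 n := fun P _ => by
    refine mem_Icc.mpr ⟨card_pos.mpr ?_, by simpa using P.card_parts_le_card⟩
    exact ⟨_, P.part_mem.mpr (mem_univ ⟨0, hn⟩)⟩
  rw [← sum_fiberwise_of_maps_to hmaps]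
  refine sum_congr rfl fun k _ => ?_
  rw [sum_congr rfl fun P hP => by rw [(mem_filter.mp hP).2], sum_const, smul_eq_mul, mul_comm,
    stirlingSecond, Nat.card_eq_fintype_card, Fintype.card_subtype]

theorem count_forests_avoiding_312_213_321 (n : ℕ) (hn : 1 ≤ n) :
    Nat.card {p : Fin n → Option (Fin n) //
        IsForest p ∧ ForestAvoids p [3, 1, 2] ∧ ForestAvoids p [2, 1, 3] ∧
        ForestAvoids p [3, 2, 1]} =
    ∑ k ∈ Finset.Icc 1 n, k.factorial * stirlingSecond n k := by
  classical
  simp only [isForest_and_avoids_iff]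
  rw [Nat.card_eq_fintype_card, Fintype.card_subtype, card_internalIncreasing,
    sum_idempotentInflationary n Nat.factorial, sum_card_parts_eq_sum_stirlingSecond hn]
end
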